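/- arXiv:1802.09309 — 4 statements merged into one kernel-verified Lean document; each statement's English description precedes it below -/
import Mathlib

section
/- Let p be a prime and let 𝒪 be a complete local Noetherian ℤ_p-algebra with finite residue field of characteristic p which is an integral domain of characteristic zero, with fraction field 𝒦 and a fixed algebraic closure 𝒦̄ of 𝒦. Let F be a number field, n ≥ 1, and ρ : Gal(F̄/F) → GL_n(𝒪) a group homomorphism such that the representation ρ ⊗ 𝒦̄ (the action of Gal(F̄/F) on 𝒦̄^n through ρ) is semisimple. Then there exists a nonzero element h ∈ 𝒪 such that for every ring homomorphism λ : 𝒪 → ℚ̄_p with λ(h) ≠ 0, the representation λ∘ρ of Gal(F̄/F) on ℚ̄_p^n is semisimple. -/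
/-- The representation of `G` on `Lⁿ` obtained from `ρ : G →* GLₙ(𝒪)` by applying a ring
homomorphism `f : 𝒪 →+* L` entrywise. -/
noncomputable def matrixRep {𝒪 L G : Type*} [CommRing 𝒪] [CommRing L] [Group G] {n : ℕ}
    (f : 𝒪 →+* L) (ρ : G →* Matrix.GeneralLinearGroup (Fin n) 𝒪) :
    Representation L G (Fin n → L) :=
  (Matrix.toLinAlgEquiv' (R := L) (n := Fin n)).toAlgHom.toRingHom.toMonoidHom.comp
    ((Units.coeHom (Matrix (Fin n) (Fin n) L)).comp
      ((Matrix.GeneralLinearGroup.map f).comp ρ))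

section TraceCriterion

variable {L : Type*} [Field L] {V : Type*} [AddCommGroup V] [Module L V]

theorem Representation.isSemisimpleModule_asModule_iff_range {G : Type*} [Group G]
    (ρ : Representation L G V) :
    IsSemisimpleModule (MonoidAlgebra L G) ρ.asModule ↔
      IsSemisimpleModule ρ.asAlgebraHom.range V := by
  let σ : MonoidAlgebra L G →+* ρ.asAlgebraHom.range := ρ.asAlgebraHom.rangeRestrict
  have : RingHomSurjective σ := ⟨ρ.asAlgebraHom.rangeRestrict_surjective⟩
  let l : ρ.asModule →ₛₗ[σ] V :=
    { toFun := ρ.asModuleEquiv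
      map_add' := map_add _
      map_smul' := fun _ _ ↦ rfl }
  exact l.isSemisimpleModule_iff_of_bijective ρ.asModuleEquiv.bijective

theorem Representation.toSubmodule_range_asAlgebraHom {G : Type*} [Group G]
    (ρ : Representation L G V) :
    Subalgebra.toSubmodule ρ.asAlgebraHom.range = Submodule.span L (Set.range ρ) := by
  apply le_antisymm
  · rintro _ ⟨x, rfl⟩
    induction x using MonoidAlgebra.induction_on with
    | of g => simpa using Submodule.subset_span (Set.mem_range_self g)
    | add x y hx hy => simpa using add_mem hx hy
    | smul r x hx => simpa using Submodule.smul_mem _ r hx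
  · rw [Submodule.span_le]
    rintro _ ⟨g, rfl⟩
    exact ⟨MonoidAlgebra.of L G g, ρ.asAlgebraHom_of g⟩

/-- The trace form of the algebra spanned by a representation is nondegenerate on the right. -/
def Representation.TraceNondegenerate {G : Type*} [Group G] (ρ : Representation L G V) : Prop :=
  ∀ a ∈ Submodule.span L (Set.range ρ), (∀ g, LinearMap.trace L V (a * ρ g) = 0) → a = 0

theorem LinearMap.trace_mul_eq_zero_of_mem_span {ι : Type*} {f : ι → Module.End L V}
    {a : Module.End L V} (h : ∀ i, LinearMap.trace L V (a * f i) = 0) {b : Module.End L V}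
    (hb : b ∈ Submodule.span L (Set.range f)) : LinearMap.trace L V (a * b) = 0 := by
  have : Submodule.span L (Set.range f) ≤
      LinearMap.ker (LinearMap.trace L V ∘ₗ LinearMap.mulLeft L a) := by
    rw [Submodule.span_le]
    rintro _ ⟨i, rfl⟩
    exact h i
  exact this hb

variable [FiniteDimensional L V]

theorem Subalgebra.isSemisimpleRing_of_isSemisimpleModule_end
    (A : Subalgebra L (Module.End L V)) [IsSemisimpleModule A V] : IsSemisimpleRing A := by
  have : IsArtinianRing A := IsArtinianRing.of_finite L A
  rw [IsArtinianRing.isSemisimpleRing_iff_jacobson, eq_bot_iff]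
  intro a ha
  have h := IsSemisimpleModule.jacobson_le_annihilator A V ha
  rw [Module.mem_annihilator] at h
  exact Subtype.ext (LinearMap.ext h)

theorem Subalgebra.eq_zero_of_trace_mul_eq_zero [CharZero L]
    (A : Subalgebra L (Module.End L V)) [IsSemisimpleModule A V] (a : A)
    (ha : ∀ b : A, LinearMap.trace L V (a * b : Module.End L V) = 0) : a = 0 := by
  have := A.isSemisimpleRing_of_isSemisimpleModule_end
  obtain ⟨e, he, hspan⟩ := IsSemisimpleRing.ideal_eq_span_idempotent (Ideal.span {a})
  obtain ⟨c, hc⟩ : ∃ c, c * a = e :=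
    Ideal.mem_span_singleton'.mp (hspan ▸ Ideal.mem_span_singleton_self e)
  obtain ⟨d, hd⟩ : ∃ d, d * e = a :=
    Ideal.mem_span_singleton'.mp (hspan ▸ Ideal.mem_span_singleton_self a)
  have he' : IsIdempotentElem (e : Module.End L V) := congrArg Subtype.val he
  have htr : LinearMap.trace L V (e : Module.End L V) = 0 := by
    rw [← hc, Subalgebra.coe_mul, LinearMap.trace_mul_comm]
    exact ha c
  have h0 : e = 0 := Subtype.ext (LinearMap.IsIdempotentElem.eq_zero_of_trace_eq_zero he' htr)
  rw [← hd, h0, mul_zero]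

theorem Subalgebra.isSemisimpleModule_end_of_trace
    (A : Subalgebra L (Module.End L V))
    (h : ∀ a : A, (∀ b : A, LinearMap.trace L V (a * b : Module.End L V) = 0) → a = 0) :
    IsSemisimpleModule A V := by
  have : IsArtinianRing A := IsArtinianRing.of_finite L A
  suffices IsSemisimpleRing A from inferInstance
  rw [IsArtinianRing.isSemisimpleRing_iff_jacobson, eq_bot_iff]
  intro a ha
  refine h a fun b ↦ ?_
  obtain ⟨k, hk⟩ := IsSemiprimaryRing.isNilpotent (R := A)
  have hab : (a * b) ^ k = 0 := by
    have := Ideal.pow_mem_pow (Ideal.mul_mem_right b _ ha) k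
    rwa [hk] at this
  have hnil : IsNilpotent ((a * b : A) : Module.End L V) :=
    ⟨k, by rw [← Subalgebra.coe_pow, hab, Subalgebra.coe_zero]⟩
  exact (LinearMap.isNilpotent_trace_of_isNilpotent hnil).eq_zero

theorem Representation.traceNondegenerate_of_isSemisimpleModule [CharZero L]
    {G : Type*} [Group G] (ρ : Representation L G V)
    (h : IsSemisimpleModule (MonoidAlgebra L G) ρ.asModule) : ρ.TraceNondegenerate := by
  intro a ha hg
  have := ρ.isSemisimpleModule_asModule_iff_range.mp h
  have ha' : a ∈ ρ.asAlgebraHom.range := by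
    rwa [← Subalgebra.mem_toSubmodule, ρ.toSubmodule_range_asAlgebraHom]
  refine congrArg Subtype.val (Subalgebra.eq_zero_of_trace_mul_eq_zero _
    (⟨a, ha'⟩ : ρ.asAlgebraHom.range) fun b ↦ LinearMap.trace_mul_eq_zero_of_mem_span hg ?_)
  rw [← ρ.toSubmodule_range_asAlgebraHom]
  exact b.2

theorem Representation.TraceNondegenerate.isSemisimpleModule
    {G : Type*} [Group G] {ρ : Representation L G V}
    (h : ρ.TraceNondegenerate) : IsSemisimpleModule (MonoidAlgebra L G) ρ.asModule := by
  rw [ρ.isSemisimpleModule_asModule_iff_range]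
  refine Subalgebra.isSemisimpleModule_end_of_trace _ fun a ha ↦ Subtype.ext (h a ?_ fun g ↦ ?_)
  · rw [← ρ.toSubmodule_range_asAlgebraHom]
    exact a.2
  · exact ha ⟨ρ g, MonoidAlgebra.of L G g, ρ.asAlgebraHom_of g⟩

end TraceCriterion

section Specialization

variable {𝒪 L G : Type*} [CommRing 𝒪] [Field L] [Group G] {n d : ℕ}

theorem matrixRep_apply (f : 𝒪 →+* L) (ρ : G →* Matrix.GeneralLinearGroup (Fin n) 𝒪) (g : G) :
    matrixRep f ρ g = Matrix.toLin' ((ρ g : Matrix (Fin n) (Fin n) 𝒪).map f) := rfl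

theorem trace_matrixRep_mul (f : 𝒪 →+* L) (ρ : G →* Matrix.GeneralLinearGroup (Fin n) 𝒪)
    (g g' : G) :
    LinearMap.trace L _ (matrixRep f ρ g * matrixRep f ρ g') =
      f (Matrix.trace (ρ g * ρ g' : Matrix (Fin n) (Fin n) 𝒪)) := by
  rw [← map_mul, matrixRep_apply, Matrix.trace_toLin'_eq, map_mul, Units.val_mul,
    AddMonoidHom.map_trace]

/-- The Gram matrix of the trace form on a finite family of elements in the image of `ρ`. -/
def traceGram (ρ : G →* Matrix.GeneralLinearGroup (Fin n) 𝒪) (s : Fin d → G) :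
    Matrix (Fin d) (Fin d) 𝒪 :=
  Matrix.of fun i j ↦ Matrix.trace (ρ (s i) * ρ (s j) : Matrix (Fin n) (Fin n) 𝒪)

theorem trace_sum_matrixRep_mul (f : 𝒪 →+* L) (ρ : G →* Matrix.GeneralLinearGroup (Fin n) 𝒪)
    (s : Fin d → G) (v : Fin d → L) (j : Fin d) :
    LinearMap.trace L _ ((∑ i, v i • matrixRep f ρ (s i)) * matrixRep f ρ (s j)) =
      Matrix.vecMul v ((traceGram ρ s).map f) j := by
  simp only [Finset.sum_mul, map_sum, smul_mul_assoc, map_smul, trace_matrixRep_mul,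
    Matrix.vecMul, dotProduct, traceGram, Matrix.map_apply, Matrix.of_apply, smul_eq_mul]

theorem det_traceGram_ne_zero (f : 𝒪 →+* L) (ρ : G →* Matrix.GeneralLinearGroup (Fin n) 𝒪)
    (h : (matrixRep f ρ).TraceNondegenerate) (s : Fin d → G)
    (hs : Submodule.span L (Set.range fun i ↦ matrixRep f ρ (s i)) =
      Submodule.span L (Set.range (matrixRep f ρ)))
    (hli : LinearIndependent L fun i ↦ matrixRep f ρ (s i)) :
    f (traceGram ρ s).det ≠ 0 := by
  intro h0
  rw [RingHom.map_det, RingHom.mapMatrix_apply, ← Matrix.exists_vecMul_eq_zero_iff] at h0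
  obtain ⟨v, hv, hvG⟩ := h0
  refine hv (funext (Fintype.linearIndependent_iff.mp hli v (h _ ?_ fun g ↦ ?_)))
  · rw [← hs]
    exact Submodule.sum_mem _ fun i _ ↦ Submodule.smul_mem _ _ (Submodule.subset_span ⟨i, rfl⟩)
  · refine LinearMap.trace_mul_eq_zero_of_mem_span
      (f := fun i ↦ matrixRep f ρ (s i)) (fun j ↦ ?_) ?_
    · rw [trace_sum_matrixRep_mul, hvG, Pi.zero_apply]
    · rw [hs]
      exact Submodule.subset_span ⟨g, rfl⟩

/-- Cramer's rule: the image of `ρ` is spanned, up to the determinant of the Gram matrix, by any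
family which spans after a faithful base change. -/
theorem det_traceGram_smul (f : 𝒪 →+* L) (hf : Function.Injective f)
    (ρ : G →* Matrix.GeneralLinearGroup (Fin n) 𝒪) (s : Fin d → G)
    (hs : Submodule.span L (Set.range fun i ↦ matrixRep f ρ (s i)) =
      Submodule.span L (Set.range (matrixRep f ρ))) (g : G) :
    ∃ w : Fin d → 𝒪, (traceGram ρ s).det • (ρ g : Matrix (Fin n) (Fin n) 𝒪) =
      ∑ i, w i • (ρ (s i) : Matrix (Fin n) (Fin n) 𝒪) := by
  have hg : matrixRep f ρ g ∈ Submodule.span L (Set.range fun i ↦ matrixRep f ρ (s i)) :=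
    hs ▸ Submodule.subset_span ⟨g, rfl⟩
  obtain ⟨c, hc⟩ := (Submodule.mem_span_range_iff_exists_fun L).mp hg
  let t : Fin d → 𝒪 := fun j ↦ Matrix.trace (ρ g * ρ (s j) : Matrix (Fin n) (Fin n) 𝒪)
  have ht : f ∘ t = Matrix.vecMul c ((traceGram ρ s).map f) := by
    funext j
    rw [← trace_sum_matrixRep_mul, hc, trace_matrixRep_mul]
    rfl
  have hw : f ∘ Matrix.vecMul t (traceGram ρ s).adjugate = f (traceGram ρ s).det • c := by
    have : f ∘ Matrix.vecMul t (traceGram ρ s).adjugate =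
        Matrix.vecMul (f ∘ t) ((traceGram ρ s).adjugate.map f) :=
      funext fun j ↦ RingHom.map_vecMul f _ _ j
    have hone : ((traceGram ρ s).det • (1 : Matrix (Fin d) (Fin d) 𝒪)).map f =
        f (traceGram ρ s).det • 1 := by
      ext i j
      simp [Matrix.one_apply, apply_ite f]
    rw [this, ht, Matrix.vecMul_vecMul, ← Matrix.map_mul, Matrix.mul_adjugate, hone,
      Matrix.vecMul_smul, Matrix.vecMul_one]
  refine ⟨Matrix.vecMul t (traceGram ρ s).adjugate, Matrix.map_injective hf ?_⟩
  have hc' : ∑ i, c i • (ρ (s i) : Matrix (Fin n) (Fin n) 𝒪).map f =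
      (ρ g : Matrix (Fin n) (Fin n) 𝒪).map f := by
    apply Matrix.toLin'.injective
    simpa [matrixRep_apply] using hc
  ext k l
  have h1 := congrFun (congrFun hc' k) l
  simp only [Matrix.sum_apply, Matrix.smul_apply, Matrix.map_apply, smul_eq_mul] at h1
  simp only [Matrix.sum_apply, Matrix.smul_apply, Matrix.map_apply, smul_eq_mul, map_sum, map_mul,
    ← h1, Finset.mul_sum]
  refine Finset.sum_congr rfl fun i _ ↦ ?_
  have h2 := congrFun hw i
  simp only [Function.comp_apply, Pi.smul_apply, smul_eq_mul] at h2
  rw [h2, mul_assoc]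

theorem traceNondegenerate_of_det_traceGram_ne_zero (f : 𝒪 →+* L)
    (ρ : G →* Matrix.GeneralLinearGroup (Fin n) 𝒪) (s : Fin d → G)
    (hs : ∀ g, ∃ w : Fin d → 𝒪, (traceGram ρ s).det • (ρ g : Matrix (Fin n) (Fin n) 𝒪) =
      ∑ i, w i • (ρ (s i) : Matrix (Fin n) (Fin n) 𝒪))
    (hdet : f (traceGram ρ s).det ≠ 0) : (matrixRep f ρ).TraceNondegenerate := by
  have hspan : Submodule.span L (Set.range (matrixRep f ρ)) ≤
      Submodule.span L (Set.range fun i ↦ matrixRep f ρ (s i)) := by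
    rw [Submodule.span_le]
    rintro _ ⟨g, rfl⟩
    obtain ⟨w, hw⟩ := hs g
    have h1 : f (traceGram ρ s).det • matrixRep f ρ g = ∑ i, f (w i) • matrixRep f ρ (s i) := by
      simp only [matrixRep_apply, ← map_smul, ← map_sum]
      congr 1
      ext k l
      have h2 := congrArg f (congrFun (congrFun hw k) l)
      simpa [Matrix.sum_apply] using h2
    refine (Submodule.smul_mem_iff _ hdet).mp (h1 ▸ ?_)
    exact Submodule.sum_mem _ fun i _ ↦ Submodule.smul_mem _ _ (Submodule.subset_span ⟨i, rfl⟩)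
  intro a ha htr
  obtain ⟨v, rfl⟩ := (Submodule.mem_span_range_iff_exists_fun L).mp (hspan ha)
  have hv : v = 0 := by
    refine Matrix.eq_zero_of_vecMul_eq_zero (M := (traceGram ρ s).map f) ?_ (funext fun j ↦ ?_)
    · rwa [RingHom.map_det] at hdet
    · rw [← trace_sum_matrixRep_mul, htr, Pi.zero_apply]
  simp [hv]

/-- Semisimplicity of `ρ` over a characteristic zero field containing `𝒪` persists under every
specialization of `𝒪` at which a suitable nonzero element does not vanish. -/
theorem exists_forall_isSemisimpleModule_matrixRep [CharZero L] (f : 𝒪 →+* L)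
    (hf : Function.Injective f) (ρ : G →* Matrix.GeneralLinearGroup (Fin n) 𝒪)
    (hss : IsSemisimpleModule (MonoidAlgebra L G) (matrixRep f ρ).asModule) :
    ∃ h : 𝒪, h ≠ 0 ∧ ∀ {L' : Type*} [Field L'] (lam : 𝒪 →+* L'), lam h ≠ 0 →
      IsSemisimpleModule (MonoidAlgebra L' G) (matrixRep lam ρ).asModule := by
  obtain ⟨b, hb, hspan, hli⟩ :=
    Submodule.exists_fun_fin_finrank_span_eq L (Set.range (matrixRep f ρ))
  choose s hs using hb
  obtain rfl : (fun i ↦ matrixRep f ρ (s i)) = b := funext hs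
  refine ⟨(traceGram ρ s).det, fun h0 ↦ ?_, fun lam hlam ↦ ?_⟩
  · exact det_traceGram_ne_zero f ρ (Representation.traceNondegenerate_of_isSemisimpleModule _ hss)
      s hspan hli (by rw [h0, map_zero])
  · exact (traceNondegenerate_of_det_traceGram_ne_zero lam ρ s
      (det_traceGram_smul f hf ρ s hspan) hlam).isSemisimpleModule

end Specialization

/-- Let `𝒪` be a complete local Noetherian `ℤ_p`-algebra with finite
residue field of characteristic `p` which is an integral domain of characteristic zero,
with fraction field `𝒦` and algebraic closure `𝒦̄` of `𝒦`. Let `F` be a number field,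
`n ≥ 1`, and `ρ : Gal(F̄/F) → GLₙ(𝒪)` a group homomorphism such that `ρ ⊗ 𝒦̄` is
semisimple. Then there is a nonzero `h ∈ 𝒪` such that for every ring homomorphism
`λ : 𝒪 → ℚ̄_p` with `λ(h) ≠ 0`, the representation `λ ∘ ρ` on `ℚ̄_pⁿ` is semisimple. -/
theorem density_of_ramified_primes_stmt9
    (p : ℕ) [Fact p.Prime]
    (𝒪 : Type) [CommRing 𝒪] [IsDomain 𝒪] [CharZero 𝒪]
    [IsLocalRing 𝒪] [IsNoetherianRing 𝒪] [Algebra ℤ_[p] 𝒪]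
    [IsAdicComplete (IsLocalRing.maximalIdeal 𝒪) 𝒪]
    [Finite (IsLocalRing.ResidueField 𝒪)] [CharP (IsLocalRing.ResidueField 𝒪) p]
    (F : Type) [Field F] [NumberField F]
    (n : ℕ) (hn : 1 ≤ n)
    (ρ : (AlgebraicClosure F ≃ₐ[F] AlgebraicClosure F) →*
      Matrix.GeneralLinearGroup (Fin n) 𝒪)
    -- `ρ ⊗ 𝒦̄` is semisimple:
    (hss : IsSemisimpleModule
      (MonoidAlgebra (AlgebraicClosure (FractionRing 𝒪))
        (AlgebraicClosure F ≃ₐ[F] AlgebraicClosure F))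
      (matrixRep ((algebraMap (FractionRing 𝒪) (AlgebraicClosure (FractionRing 𝒪))).comp
        (algebraMap 𝒪 (FractionRing 𝒪))) ρ).asModule) :
    ∃ h : 𝒪, h ≠ 0 ∧
      ∀ lam : 𝒪 →+* AlgebraicClosure ℚ_[p], lam h ≠ 0 →
        IsSemisimpleModule
          (MonoidAlgebra (AlgebraicClosure ℚ_[p])
            (AlgebraicClosure F ≃ₐ[F] AlgebraicClosure F))
          (matrixRep lam ρ).asModule := by
  have : CharZero (AlgebraicClosure (FractionRing 𝒪)) :=
    charZero_of_injective_algebraMap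
      (algebraMap (FractionRing 𝒪) (AlgebraicClosure (FractionRing 𝒪))).injective
  have hf : Function.Injective ((algebraMap (FractionRing 𝒪)
      (AlgebraicClosure (FractionRing 𝒪))).comp (algebraMap 𝒪 (FractionRing 𝒪))) := by
    rw [RingHom.coe_comp]
    exact (RingHom.injective _).comp (IsFractionRing.injective 𝒪 (FractionRing 𝒪))
  obtain ⟨h, h0, H⟩ := exists_forall_isSemisimpleModule_matrixRep _ hf ρ hss
  exact ⟨h, h0, fun lam hlam ↦ H lam hlam⟩
end

section
/- Let 𝒪 be a Noetherian integral domain with fraction field 𝒦 of characteristic zero, with a fixed algebraic closure 𝒦̄ of 𝒦, and assume that the integral closure of 𝒪 in every finite field extension of 𝒦 is Noetherian. Let G be a group, n ≥ 1, and ρ : G → GL_n(𝒪) a group homomorphism such that the representation ρ ⊗ 𝒦̄ of G on 𝒦̄^n is semisimple. Then there exist: a finite field extension 𝒦' of 𝒦 contained in 𝒦̄; a nonzero element f of the integral closure 𝒪' of 𝒪 in 𝒦'; positive integers n_1,…,n_r with n_1 + ⋯ + n_r = n; and group homomorphisms ρ_i : G → GL_{n_i}(𝒪'_f) for 1 ≤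 i ≤ r, such that for each i the representation ρ_i ⊗ 𝒦̄ of G on 𝒦̄^{n_i} is irreducible, and the 𝒪'_f[G]-module (𝒪'_f)^n obtained from ρ by extension of scalars is isomorphic to the direct sum of the 𝒪'_f[G]-modules given by ρ_1,…,ρ_r. -/
set_option synthInstance.maxHeartbeats 1000000
set_option maxHeartbeats 2000000

open scoped BigOperators

theorem toMatrix'_matrixRep {𝒪 L G : Type*} [CommRing 𝒪] [CommRing L] [Group G] {n : ℕ}
    (f : 𝒪 →+* L) (ρ : G →* Matrix.GeneralLinearGroup (Fin n) 𝒪) (g : G) :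
    LinearMap.toMatrix' (matrixRep f ρ g) = (ρ g : Matrix (Fin n) (Fin n) 𝒪).map f :=
  LinearMap.toMatrix'_toLin' _

/-- A `k`-linear equivalence commuting with the group elements is `k[G]`-linear. -/
theorem nonempty_linearEquiv_of_comm {k G M N : Type*} [CommRing k] [Group G]
    [AddCommGroup M] [AddCommGroup N] [Module k M] [Module k N]
    [Module (MonoidAlgebra k G) M] [Module (MonoidAlgebra k G) N]
    [IsScalarTower k (MonoidAlgebra k G) M] [IsScalarTower k (MonoidAlgebra k G) N]
    (e : M ≃ₗ[k] N)
    (h : ∀ (g : G) (m : M), e (MonoidAlgebra.single g (1 : k) • m) =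
      MonoidAlgebra.single g (1 : k) • e m) :
    Nonempty (M ≃ₗ[MonoidAlgebra k G] N) :=
  ⟨LinearEquiv.ofBijective (MonoidAlgebra.equivariantOfLinearOfComm e.toLinearMap h) e.bijective⟩

/-- A finite-dimensional representation which is a product of simple modules is block diagonal in
a suitable basis, with blocks that are matrices of irreducible representations. -/
theorem Representation.exists_blockDiagonal_of_linearEquiv {L G : Type*} [Field L] [Group G]
    {n r : ℕ} (σ : Representation L G (Fin n → L)) {S : Fin r → Type*} [∀ i, AddCommGroup (S i)]
    [∀ i, Module L (S i)] [∀ i, Module (MonoidAlgebra L G) (S i)]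
    [∀ i, IsScalarTower L (MonoidAlgebra L G) (S i)]
    [∀ i, IsSimpleModule (MonoidAlgebra L G) (S i)]
    (e : σ.asModule ≃ₗ[MonoidAlgebra L G] ∀ i, S i) :
    ∃ d : Fin r → ℕ, (∀ i, 0 < d i) ∧ ∑ i, d i = n ∧
      ∃ (P : Matrix (Fin n) (Σ i, Fin (d i)) L) (Q : Matrix (Σ i, Fin (d i)) (Fin n) L)
        (B : ∀ i, G → Matrix (Fin (d i)) (Fin (d i)) L),
        P * Q = 1 ∧ Q * P = 1 ∧
        (∀ g, Q * LinearMap.toMatrix' (σ g) * P = Matrix.blockDiagonal' fun i => B i g) ∧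
        ∀ (i) (τ : Representation L G (Fin (d i) → L)),
          (∀ g, LinearMap.toMatrix' (τ g) = B i g) →
            IsSimpleModule (MonoidAlgebra L G) τ.asModule := by
  let eL : (Fin n → L) ≃ₗ[L] ∀ i, S i := σ.asModuleEquiv.symm.trans (e.restrictScalars L)
  have : Module.Finite L (∀ i, S i) := Module.Finite.equiv eL
  have hfin (i) : Module.Finite L (S i) :=
    Module.Finite.of_surjective (LinearMap.proj i : (∀ i, S i) →ₗ[L] S i)
      (Function.surjective_eval i)
  let b (i) : Module.Basis (Fin (Module.finrank L (S i))) L (S i) := Module.finBasis L (S i)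
  let bb := Pi.basis b
  let act (i) (g : G) : S i →ₗ[L] S i :=
    Algebra.lsmul L L (S i) (MonoidAlgebra.single g (1 : L))
  have heL (g : G) (v) (i) : eL (σ g v) i = act i g (eL v i) := by
    have : σ.asModuleEquiv.symm (σ g v) =
        MonoidAlgebra.single g (1 : L) • σ.asModuleEquiv.symm v :=
      Representation.asModuleEquiv_symm_map_rho σ g v
    change e (σ.asModuleEquiv.symm (σ g v)) i = _
    rw [this, map_smul]
    rfl
  have hact (g : G) : LinearMap.toMatrix bb bb (LinearMap.pi fun i => act i g ∘ₗ LinearMap.proj i) =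
      Matrix.blockDiagonal' fun i => LinearMap.toMatrix (b i) (b i) (act i g) := by
    ext ⟨i, x⟩ ⟨j, y⟩
    rw [LinearMap.toMatrix_apply]
    simp only [bb, Pi.basis_repr, Pi.basis_apply, Matrix.blockDiagonal'_apply]
    split_ifs with h
    · subst h
      simp [LinearMap.toMatrix_apply]
    · simp [Pi.single_eq_of_ne h]
  let s := Pi.basisFun L (Fin n)
  refine ⟨fun i => Module.finrank L (S i), fun i => ?_, ?_,
    LinearMap.toMatrix bb s eL.symm.toLinearMap, LinearMap.toMatrix s bb eL.toLinearMap,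
    fun i g => LinearMap.toMatrix (b i) (b i) (act i g), ?_, ?_, fun g => ?_, fun i τ hτ => ?_⟩
  · have := IsSimpleModule.nontrivial (MonoidAlgebra L G) (S i)
    exact Module.finrank_pos (R := L) (M := S i)
  · rw [← Module.finrank_pi_fintype L, ← eL.finrank_eq, Module.finrank_fin_fun]
  · rw [← LinearMap.toMatrix_comp, LinearEquiv.comp_coe, LinearEquiv.self_trans_symm]
    exact LinearMap.toMatrix_id s
  · rw [← LinearMap.toMatrix_comp, LinearEquiv.comp_coe, LinearEquiv.symm_trans_self]
    exact LinearMap.toMatrix_id bb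
  · rw [← hact, ← LinearMap.toMatrix_eq_toMatrix', ← LinearMap.toMatrix_comp,
      ← LinearMap.toMatrix_comp]
    congr 1
    refine LinearMap.ext fun v => funext fun i => ?_
    simpa using heL g (eL.symm v) i
  · have hτ' (g) (v : S i) : (b i).equivFun (act i g v) = τ g ((b i).equivFun v) := by
      rw [← LinearMap.toMatrix'_mulVec, hτ]
      exact (LinearMap.toMatrix_mulVec_repr (b i) (b i) (act i g) v).symm
    obtain ⟨u⟩ := nonempty_linearEquiv_of_comm (G := G)
      ((b i).equivFun.trans τ.asModuleEquiv.symm) (fun g m => by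
        change (b i).equivFun (act i g m) = _
        rw [hτ']
        exact Representation.asModuleEquiv_symm_map_rho τ g _)
    exact IsSimpleModule.congr u.symm

/-- A finite-dimensional semisimple representation is block diagonal in a suitable basis, with
blocks that are matrices of irreducible representations. -/
theorem Representation.exists_blockDiagonal {L G : Type*} [Field L] [Group G] {n : ℕ}
    (σ : Representation L G (Fin n → L))
    [IsSemisimpleModule (MonoidAlgebra L G) σ.asModule] :
    ∃ (r : ℕ) (d : Fin r → ℕ), (∀ i, 0 < d i) ∧ ∑ i, d i = n ∧
      ∃ (P : Matrix (Fin n) (Σ i, Fin (d i)) L) (Q : Matrix (Σ i, Fin (d i)) (Fin n) L)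
        (B : ∀ i, G → Matrix (Fin (d i)) (Fin (d i)) L),
        P * Q = 1 ∧ Q * P = 1 ∧
        (∀ g, Q * LinearMap.toMatrix' (σ g) * P = Matrix.blockDiagonal' fun i => B i g) ∧
        ∀ (i) (τ : Representation L G (Fin (d i) → L)),
          (∀ g, LinearMap.toMatrix' (τ g) = B i g) →
            IsSimpleModule (MonoidAlgebra L G) τ.asModule := by
  have : Module.Finite (MonoidAlgebra L G) σ.asModule :=
    Module.Finite.of_restrictScalars_finite L _ _
  obtain ⟨r, S, e₀, hS⟩ :=
    IsSemisimpleModule.exists_linearEquiv_fin_dfinsupp (MonoidAlgebra L G) σ.asModule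
  exact ⟨r, Representation.exists_blockDiagonal_of_linearEquiv σ (S := fun i => S i)
    (e₀.trans (DFinsupp.linearEquivFunOnFintype (R := MonoidAlgebra L G)))⟩

/-- If `ρ` is conjugate to a block diagonal family, then the blocks are representations and
`ρ` is isomorphic to their direct sum. -/
theorem exists_blocks_of_blockDiagonal {𝒪 A G : Type*} [CommRing 𝒪] [CommRing A] [Group G]
    {n r : ℕ} {d : Fin r → ℕ} (f : 𝒪 →+* A) (ρ : G →* Matrix.GeneralLinearGroup (Fin n) 𝒪)
    (P : Matrix (Fin n) (Σ i, Fin (d i)) A) (Q : Matrix (Σ i, Fin (d i)) (Fin n) A)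
    (B : ∀ i, G → Matrix (Fin (d i)) (Fin (d i)) A) (hPQ : P * Q = 1) (hQP : Q * P = 1)
    (hB : ∀ g, Q * (ρ g : Matrix (Fin n) (Fin n) 𝒪).map f * P =
      Matrix.blockDiagonal' fun i => B i g) :
    ∃ ρi : ∀ i, G →* Matrix.GeneralLinearGroup (Fin (d i)) A,
      (∀ i g, (ρi i g : Matrix (Fin (d i)) (Fin (d i)) A) = B i g) ∧
      Nonempty ((matrixRep f ρ).asModule ≃ₗ[MonoidAlgebra A G]
        (∀ i, (matrixRep (RingHom.id A) (ρi i)).asModule)) := by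
  have hone : (fun i => B i 1) = 1 := by
    apply Matrix.blockDiagonal'_injective
    rw [← hB, Matrix.blockDiagonal'_one]
    simp [Matrix.map_one, hQP]
  have hmul (g h : G) : (fun i => B i (g * h)) = fun i => B i g * B i h := by
    apply Matrix.blockDiagonal'_injective
    rw [Matrix.blockDiagonal'_mul, ← hB, ← hB, ← hB]
    simp only [map_mul, Units.val_mul, Matrix.map_mul, Matrix.mul_assoc]
    rw [← Matrix.mul_assoc P Q, hPQ, Matrix.one_mul]
  let ρi (i) : G →* Matrix.GeneralLinearGroup (Fin (d i)) A := MonoidHom.toHomUnits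
    { toFun := B i
      map_one' := congrFun hone i
      map_mul' := fun g h => congrFun (hmul g h) i }
  refine ⟨ρi, fun i g => rfl, ?_⟩
  let eQ : (Fin n → A) ≃ₗ[A] ((Σ i, Fin (d i)) → A) := Matrix.toLin'OfInv hPQ hQP
  let e : (Fin n → A) ≃ₗ[A] (∀ i, Fin (d i) → A) :=
    eQ.trans (LinearEquiv.piCurry A fun i (_ : Fin (d i)) => A)
  have he (g : G) (v) (i) :
      e (matrixRep f ρ g v) i = matrixRep (RingHom.id A) (ρi i) g (e v i) := by
    have h : Q.mulVec (((ρ g : Matrix (Fin n) (Fin n) 𝒪).map f).mulVec v) =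
        (Matrix.blockDiagonal' fun i => B i g).mulVec (Q.mulVec v) := by
      rw [← hB, Matrix.mulVec_mulVec, Matrix.mulVec_mulVec, Matrix.mul_assoc _ P, hPQ,
        Matrix.mul_one]
    ext x
    refine (congrFun h ⟨i, x⟩).trans ?_
    rw [Matrix.mulVec, dotProduct, Fintype.sum_sigma, Finset.sum_eq_single i]
    · simp only [Matrix.blockDiagonal'_apply_eq]
      rfl
    · intro j _ hj
      exact Finset.sum_eq_zero fun y _ => by
        rw [Matrix.blockDiagonal'_apply_ne _ _ _ hj.symm, zero_mul]
    · simp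
  refine nonempty_linearEquiv_of_comm (G := G)
    ((matrixRep f ρ).asModuleEquiv.trans (e.trans (LinearEquiv.piCongrRight fun i =>
      (matrixRep (RingHom.id A) (ρi i)).asModuleEquiv.symm))) fun g m => ?_
  ext1 i
  have h₁ : (matrixRep f ρ).asModuleEquiv (MonoidAlgebra.single g (1 : A) • m) =
      matrixRep f ρ g ((matrixRep f ρ).asModuleEquiv m) := by
    rw [Representation.asModuleEquiv_map_smul, Representation.asAlgebraHom_single_one]
  have h₂ := Representation.asModuleEquiv_symm_map_rho (matrixRep (RingHom.id A) (ρi i)) g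
    (e ((matrixRep f ρ).asModuleEquiv m) i)
  simp only [LinearEquiv.trans_apply, LinearEquiv.piCongrRight_apply, h₁, he]
  exact h₂

/-- Finitely many elements of an algebraic extension of `Frac 𝒪` lie in some `𝒪'_f`, where `𝒪'`
is the integral closure of `𝒪` in a finite extension. -/
theorem exists_integralClosure_away {𝒪 K L : Type*} [CommRing 𝒪] [IsDomain 𝒪] [Field K] [Field L]
    [Algebra 𝒪 K] [IsFractionRing 𝒪 K] [Algebra K L] [Algebra.IsAlgebraic K L]
    [Algebra 𝒪 L] [IsScalarTower 𝒪 K L]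
    {ι : Type*} [Finite ι] (x : ι → L) :
    ∃ K' : IntermediateField K L, FiniteDimensional K K' ∧
      ∃ f : integralClosure 𝒪 K', f ≠ 0 ∧
      ∃ φ : Localization.Away f →+* L, Function.Injective φ ∧
        φ.comp (algebraMap (integralClosure 𝒪 K') (Localization.Away f)) =
          (algebraMap K' L).comp (algebraMap (integralClosure 𝒪 K') K') ∧
        ∀ i, x i ∈ φ.range := by
  let K' : IntermediateField K L := IntermediateField.adjoin K (Set.range x)
  have hfin : FiniteDimensional K K' :=
    IntermediateField.finiteDimensional_adjoin fun y _ => Algebra.IsIntegral.isIntegral y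
  have hfrac : IsFractionRing (integralClosure 𝒪 K') K' :=
    integralClosure.isFractionRing_of_finite_extension K K'
  have hx (i) : x i ∈ K' := IntermediateField.subset_adjoin K _ ⟨i, rfl⟩
  obtain ⟨⟨f, hf⟩, hdenom⟩ := IsLocalization.exist_integer_multiples_of_finite
    (nonZeroDivisors (integralClosure 𝒪 K')) (fun i => (⟨x i, hx i⟩ : K'))
  have hf0 : f ≠ 0 := nonZeroDivisors.ne_zero hf
  let ψ : integralClosure 𝒪 K' →+* L :=
    (algebraMap K' L).comp (algebraMap (integralClosure 𝒪 K') K')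
  have hψ : Function.Injective ψ :=
    (algebraMap K' L).injective.comp (IsFractionRing.injective _ K')
  have hψf : ψ f ≠ 0 := (map_ne_zero_iff ψ hψ).2 hf0
  let φ : Localization.Away f →+* L := IsLocalization.Away.lift f (isUnit_iff_ne_zero.2 hψf)
  have hφ : φ.comp (algebraMap (integralClosure 𝒪 K') (Localization.Away f)) = ψ :=
    IsLocalization.Away.lift_comp f _
  refine ⟨K', hfin, f, hf0, φ, ?_, hφ, fun i => ?_⟩
  · exact (IsLocalization.lift_injective_iff _).2 fun a b => by
      rw [hψ.eq_iff, (IsLocalization.injective (Localization.Away f)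
        (powers_le_nonZeroDivisors_of_noZeroDivisors hf0)).eq_iff]
  · obtain ⟨y, hy⟩ := hdenom i
    have hy' : ψ y = ψ f * x i := by
      change ((algebraMap (integralClosure 𝒪 K') K' y : K') : L) = _
      rw [hy]
      rfl
    refine ⟨IsLocalization.mk' (Localization.Away f) y
      (⟨f, Submonoid.mem_powers f⟩ : Submonoid.powers f), ?_⟩
    refine mul_left_cancel₀ hψf ?_
    rw [← hy', ← hφ, RingHom.comp_apply, RingHom.comp_apply, ← map_mul,
      IsLocalization.mk'_spec' (Localization.Away f) y
        (⟨f, Submonoid.mem_powers f⟩ : Submonoid.powers f)]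

/-- Let `𝒪` be a Noetherian integral domain whose fraction field `𝒦`
has characteristic zero, with algebraic closure `𝒦̄`, and suppose the integral closure of
`𝒪` in every finite extension of `𝒦` is Noetherian. Let `ρ : G → GLₙ(𝒪)` be such that
`ρ ⊗ 𝒦̄` is semisimple. Then there are a finite extension `𝒦'` of `𝒦` inside `𝒦̄`, a
nonzero `f` in the integral closure `𝒪'` of `𝒪` in `𝒦'`, integers `n₁ + ⋯ + n_r = n` and
representations `ρᵢ : G → GL_{nᵢ}(𝒪'_f)` with each `ρᵢ ⊗ 𝒦̄` irreducible, such that the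
`𝒪'_f[G]`-module `(𝒪'_f)ⁿ` obtained from `ρ` is isomorphic to the direct sum of the
modules given by the `ρᵢ`. -/
theorem density_of_ramified_primes_stmt11
    (𝒪 : Type) [CommRing 𝒪] [IsDomain 𝒪] [IsNoetherianRing 𝒪]
    [CharZero (FractionRing 𝒪)]
    (hNoeth : ∀ K' : IntermediateField (FractionRing 𝒪)
        (AlgebraicClosure (FractionRing 𝒪)),
      FiniteDimensional (FractionRing 𝒪) K' → IsNoetherianRing (integralClosure 𝒪 K'))
    (G : Type) [Group G] (n : ℕ) (hn : 1 ≤ n)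
    (ρ : G →* Matrix.GeneralLinearGroup (Fin n) 𝒪)
    -- `ρ ⊗ 𝒦̄` is semisimple:
    (hss : IsSemisimpleModule
      (MonoidAlgebra (AlgebraicClosure (FractionRing 𝒪)) G)
      (matrixRep ((algebraMap (FractionRing 𝒪) (AlgebraicClosure (FractionRing 𝒪))).comp
        (algebraMap 𝒪 (FractionRing 𝒪))) ρ).asModule) :
    ∃ K' : IntermediateField (FractionRing 𝒪) (AlgebraicClosure (FractionRing 𝒪)),
      FiniteDimensional (FractionRing 𝒪) K' ∧
      ∃ f : integralClosure 𝒪 K', f ≠ 0 ∧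
      ∃ (r : ℕ) (ni : Fin r → ℕ), (∀ i, 0 < ni i) ∧ (∑ i, ni i) = n ∧
      ∃ ρi : (i : Fin r) → G →* Matrix.GeneralLinearGroup (Fin (ni i))
          (Localization.Away f),
        -- the canonical map `𝒪'_f → 𝒦̄` (inverting the image of `f`, which is nonzero):
        (∃ lift : Localization.Away f →+* AlgebraicClosure (FractionRing 𝒪),
          lift.comp (algebraMap (integralClosure 𝒪 K') (Localization.Away f)) =
            (algebraMap K' (AlgebraicClosure (FractionRing 𝒪))).comp
              (algebraMap (integralClosure 𝒪 K') K') ∧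
          -- each `ρᵢ ⊗ 𝒦̄` is irreducible:
          ∀ i, IsSimpleModule
            (MonoidAlgebra (AlgebraicClosure (FractionRing 𝒪)) G)
            (matrixRep lift (ρi i)).asModule) ∧
        -- `(𝒪'_f)ⁿ` with the `G`-action via `ρ` is the direct sum of the `ρᵢ`:
        Nonempty
          ((matrixRep ((algebraMap (integralClosure 𝒪 K') (Localization.Away f)).comp
              (algebraMap 𝒪 (integralClosure 𝒪 K'))) ρ).asModule
            ≃ₗ[MonoidAlgebra (Localization.Away f) G]
          ((i : Fin r) → (matrixRep (RingHom.id (Localization.Away f))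
            (ρi i)).asModule)) := by
  obtain ⟨r, d, hd, hsum, P, Q, B, hPQ, hQP, hB, hsimple⟩ :=
    Representation.exists_blockDiagonal (matrixRep
      ((algebraMap (FractionRing 𝒪) (AlgebraicClosure (FractionRing 𝒪))).comp
        (algebraMap 𝒪 (FractionRing 𝒪))) ρ)
  obtain ⟨K', hK', f, hf, φ, hφ, hφc, hx⟩ := exists_integralClosure_away (𝒪 := 𝒪)
    (K := FractionRing 𝒪)
    (Sum.elim (fun p : Fin n × (Σ i, Fin (d i)) => P p.1 p.2)
      fun p : Fin n × (Σ i, Fin (d i)) => Q p.2 p.1)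
  choose P' hP' using fun a b => hx (Sum.inl (a, b))
  choose Q' hQ' using fun a b => hx (Sum.inr (b, a))
  replace hP' : (Matrix.of P').map φ = P := Matrix.ext hP'
  replace hQ' : (Matrix.of Q').map φ = Q := Matrix.ext hQ'
  have hφ𝒪 : φ.comp ((algebraMap (integralClosure 𝒪 K') (Localization.Away f)).comp
      (algebraMap 𝒪 (integralClosure 𝒪 K'))) =
      (algebraMap (FractionRing 𝒪) (AlgebraicClosure (FractionRing 𝒪))).comp
        (algebraMap 𝒪 (FractionRing 𝒪)) := by
    rw [← RingHom.comp_assoc, hφc]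
    rfl
  let C (g : G) : Matrix (Σ i, Fin (d i)) (Σ i, Fin (d i)) (Localization.Away f) :=
    Matrix.of Q' * (ρ g : Matrix (Fin n) (Fin n) 𝒪).map
      ((algebraMap (integralClosure 𝒪 K') (Localization.Away f)).comp
        (algebraMap 𝒪 (integralClosure 𝒪 K'))) * Matrix.of P'
  have hC (g : G) : (C g).map φ = Matrix.blockDiagonal' fun i => B i g := by
    rw [← hB, toMatrix'_matrixRep, ← hφ𝒪, Matrix.map_mul, Matrix.map_mul, hP', hQ',
      Matrix.map_map]
    rfl
  have hCB (i g) : (Matrix.blockDiag' (C g) i).map φ = B i g := by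
    change Matrix.blockDiag' ((C g).map φ) i = _
    rw [hC, Matrix.blockDiag'_blockDiagonal']
  have hinj {α β : Type} := Matrix.map_injective (m := α) (n := β) hφ
  obtain ⟨ρi, hρi, e⟩ := exists_blocks_of_blockDiagonal
    ((algebraMap (integralClosure 𝒪 K') (Localization.Away f)).comp
      (algebraMap 𝒪 (integralClosure 𝒪 K'))) ρ (Matrix.of P') (Matrix.of Q')
    (fun i g => Matrix.blockDiag' (C g) i)
    (hinj (by simp [Matrix.map_mul, hP', hQ', hPQ, Matrix.map_one]))
    (hinj (by simp [Matrix.map_mul, hP', hQ', hQP, Matrix.map_one]))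
    (fun g => hinj (by
      change (C g).map φ = Matrix.map _ φ
      rw [hC, Matrix.blockDiagonal'_map _ _ (map_zero φ)]
      simp only [hCB]))
  refine ⟨K', hK', f, hf, r, d, hd, hsum, ρi, ⟨φ, hφc, fun i => hsimple i _ fun g => ?_⟩, e⟩
  rw [toMatrix'_matrixRep, hρi, hCB]
end

section
/- Let 𝒪 be a Noetherian integral domain with fraction field 𝒦, G a group, n ≥ 1, and ρ : G → GL_n(𝒪) a group homomorphism; let T = 𝒪^n with G acting through ρ. Suppose the 𝒦[G]-module T ⊗_𝒪 𝒦 = 𝒦^n decomposes as a direct sum V_1 ⊕ V_2 of two nonzero G-stable 𝒦-subspaces, and set T_i = T ∩ V_i. Then there exists a nonzero f ∈ 𝒪 such that, over the localization 𝒪_f, the modules T_1 ⊗_𝒪 𝒪_f and T_2 ⊗_𝒪 𝒪_f are finite free 𝒪_f-modules, and T ⊗_𝒪 𝒪_f is the direct sum of its G-stable submodules T_1 ⊗_𝒪 𝒪_f and T_2 ⊗_𝒪 𝒪_f. -/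
set_option synthInstance.maxHeartbeats 1000000
set_option maxHeartbeats 2000000

/-- The lattice `Rⁿ` inside `Kⁿ`. -/
abbrev standardLattice (R K : Type*) [CommRing R] [Field K] [Algebra R K] (n : ℕ) :
    Submodule R (Fin n → K) :=
  LinearMap.range (LinearMap.pi fun i : Fin n =>
    (Algebra.linearMap R K).comp (LinearMap.proj i))

section Lattice

variable {R K : Type*} [CommRing R] [Field K] [Algebra R K] {n : ℕ}

theorem mem_standardLattice {x : Fin n → K} :
    x ∈ standardLattice R K n ↔ ∀ i, ∃ a : R, algebraMap R K a = x i := by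
  constructor
  · rintro ⟨y, rfl⟩ i
    exact ⟨y i, rfl⟩
  · intro h
    choose y hy using h
    exact ⟨y, funext hy⟩

theorem mulVec_mem_standardLattice (M : Matrix (Fin n) (Fin n) R) {x : Fin n → K}
    (hx : x ∈ standardLattice R K n) :
    (M.map (algebraMap R K)).mulVec x ∈ standardLattice R K n := by
  obtain ⟨y, rfl⟩ := hx
  exact ⟨M.mulVec y, funext fun i => by simp [Matrix.mulVec, dotProduct]⟩

theorem mulVec_mem_span (A : Subalgebra R K) (M : Matrix (Fin n) (Fin n) K)
    {S : Set (Fin n → K)} (hM : ∀ s ∈ S, M.mulVec s ∈ S) {v : Fin n → K}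
    (hv : v ∈ Submodule.span A S) : M.mulVec v ∈ Submodule.span A S := by
  induction hv using Submodule.span_induction with
  | mem x hx => exact Submodule.subset_span (hM x hx)
  | zero => simp
  | add x y _ _ hx hy => rw [Matrix.mulVec_add]; exact add_mem hx hy
  | smul a x _ hx => rw [Matrix.mulVec_smul]; exact Submodule.smul_mem _ a hx

variable [IsFractionRing R K]

theorem inv_algebraMap_mem_of_mul {A : Subalgebra R K} {d e : R} (he : e ≠ 0)
    (h : (algebraMap R K (d * e))⁻¹ ∈ A) : (algebraMap R K d)⁻¹ ∈ A := by
  have he' : algebraMap R K e ≠ 0 := by simpa using he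
  have : (algebraMap R K d)⁻¹ = algebraMap R K e * (algebraMap R K (d * e))⁻¹ := by
    rw [map_mul, mul_inv, mul_left_comm, mul_inv_cancel₀ he', mul_one]
  rw [this]
  exact A.mul_mem (A.algebraMap_mem e) h

variable [IsDomain R]

/-- Finitely many elements of the fraction field have a common denominator. -/
theorem exists_common_denominator {ι : Type*} [Finite ι] (g : ι → K) :
    ∃ d : R, d ≠ 0 ∧ ∀ i, ∃ a : R, algebraMap R K a = algebraMap R K d * g i := by
  obtain ⟨d, hd⟩ := IsLocalization.exist_integer_multiples_of_finite (nonZeroDivisors R) g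
  refine ⟨d, nonZeroDivisors.ne_zero d.2, fun i => ?_⟩
  obtain ⟨a, ha⟩ := hd i
  exact ⟨a, by rw [ha, Algebra.smul_def]⟩

/-- If `P` is a projection of `Kⁿ` onto `V`, then after inverting a suitable nonzero element of
`R` the lattice `Rⁿ ∩ V` becomes finite free and contains `P(Rⁿ)`. -/
theorem exists_localization_free (V : Submodule K (Fin n → K))
    (P : (Fin n → K) →ₗ[K] V) (hP : ∀ v : V, P v = v) :
    ∃ f : R, f ≠ 0 ∧ ∀ A : Subalgebra R K, (algebraMap R K f)⁻¹ ∈ A →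
      Module.Free A (Submodule.span A
        ((standardLattice R K n ⊓ V.restrictScalars R : Submodule R (Fin n → K)) :
          Set (Fin n → K))) ∧
      Module.Finite A (Submodule.span A
        ((standardLattice R K n ⊓ V.restrictScalars R : Submodule R (Fin n → K)) :
          Set (Fin n → K))) ∧
      ∀ t ∈ standardLattice R K n, (P t : Fin n → K) ∈ Submodule.span A
        ((standardLattice R K n ⊓ V.restrictScalars R : Submodule R (Fin n → K)) :
          Set (Fin n → K)) := by
  let b := Module.finBasis K V
  obtain ⟨d, hd, hdb⟩ := exists_common_denominator (R := R)
    (fun p : Fin (Module.finrank K V) × Fin n => (b p.1 : Fin n → K) p.2)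
  obtain ⟨e, he, heb⟩ := exists_common_denominator (R := R)
    (fun p : Fin (Module.finrank K V) × Fin n => b.repr (P (Pi.single p.2 1)) p.1)
  refine ⟨d * e, mul_ne_zero hd he, fun A hA => ?_⟩
  have hdA : (algebraMap R K d)⁻¹ ∈ A := inv_algebraMap_mem_of_mul he hA
  have heA : (algebraMap R K e)⁻¹ ∈ A := inv_algebraMap_mem_of_mul hd (mul_comm d e ▸ hA)
  have hd' : algebraMap R K d ≠ 0 := by simpa using hd
  have he' : algebraMap R K e ≠ 0 := by simpa using he
  set S : Set (Fin n → K) :=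
    ((standardLattice R K n ⊓ V.restrictScalars R : Submodule R (Fin n → K)) :
      Set (Fin n → K))
  let c : Fin (Module.finrank K V) → Fin n → K := fun j => b j
  have hcoord : ∀ t ∈ standardLattice R K n, ∀ j, b.repr (P t) j ∈ A := by
    intro t ht j
    have hsum : t = ∑ i, t i • Pi.single i (1 : K) := by
      ext k
      simp [Finset.sum_apply, Pi.single_apply]
    rw [hsum]
    simp only [map_sum, map_smul, Finsupp.coe_finsetSum, Finset.sum_apply, Finsupp.smul_apply,
      smul_eq_mul]
    refine A.sum_mem fun i _ => A.mul_mem ?_ ?_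
    · obtain ⟨a, ha⟩ := mem_standardLattice.1 ht i
      exact ha ▸ A.algebraMap_mem a
    · obtain ⟨a, ha⟩ := heb (j, i)
      rw [← inv_mul_cancel_left₀ he' (b.repr _ j), ← ha]
      exact A.mul_mem heA (A.algebraMap_mem a)
  have hPc : ∀ t ∈ standardLattice R K n,
      (P t : Fin n → K) ∈ Submodule.span A (Set.range c) := by
    intro t ht
    have hsum : (P t : Fin n → K) =
        ∑ j, (⟨b.repr (P t) j, hcoord t ht j⟩ : A) • c j := by
      conv_lhs => rw [← b.sum_repr (P t)]
      rw [Submodule.coe_sum]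
      rfl
    rw [hsum]
    exact Submodule.sum_mem _ fun j _ =>
      Submodule.smul_mem _ _ (Submodule.subset_span ⟨j, rfl⟩)
  have hspan : Submodule.span A S = Submodule.span A (Set.range c) := by
    apply le_antisymm
    · refine Submodule.span_le.2 fun t ht => ?_
      have := hPc t ht.1
      rwa [hP ⟨t, ht.2⟩] at this
    · refine Submodule.span_le.2 ?_
      rintro _ ⟨j, rfl⟩
      have hmem : algebraMap R K d • c j ∈ S :=
        ⟨mem_standardLattice.2 fun i => hdb (j, i), V.smul_mem _ (b j).2⟩
      have heq : c j = (⟨_, hdA⟩ : A) • (algebraMap R K d • c j) :=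
        (inv_smul_smul₀ hd' (c j)).symm
      rw [heq]
      exact Submodule.smul_mem _ _ (Submodule.subset_span hmem)
  have hlin : LinearIndependent A c := by
    have hK : LinearIndependent K c := b.linearIndependent.map' V.subtype V.ker_subtype
    exact hK.restrict_scalars' A
  rw [hspan]
  exact ⟨Module.Free.of_basis (Module.Basis.span hlin),
    Module.Finite.of_basis (Module.Basis.span hlin), hPc⟩

end Lattice

/-- Let `𝒪` be a Noetherian integral domain with fraction field `𝒦`,
`G` a group, and `ρ : G → GLₙ(𝒪)`; let `T = 𝒪ⁿ` with `G` acting through `ρ`, viewed inside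
`𝒦ⁿ`. Suppose `𝒦ⁿ = V₁ ⊕ V₂` with `V₁, V₂` nonzero `G`-stable `𝒦`-subspaces, and set
`Tᵢ = T ∩ Vᵢ`. Then there is a nonzero `f ∈ 𝒪` such that, over the localization
`𝒪_f = 𝒪[1/f] ⊆ 𝒦`, the modules `Tᵢ ⊗ 𝒪_f` (realized as the `𝒪_f`-spans of the `Tᵢ` in
`𝒦ⁿ`) are finite free `𝒪_f`-modules, and `T ⊗ 𝒪_f` is the direct sum of its `G`-stable
submodules `T₁ ⊗ 𝒪_f` and `T₂ ⊗ 𝒪_f`. -/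
theorem density_of_ramified_primes_stmt12
    (𝒪 : Type*) [CommRing 𝒪] [IsDomain 𝒪] [IsNoetherianRing 𝒪]
    (G : Type*) [Group G] (n : ℕ) (hn : 1 ≤ n)
    (ρ : G →* Matrix.GeneralLinearGroup (Fin n) 𝒪)
    (V₁ V₂ : Submodule (FractionRing 𝒪) (Fin n → FractionRing 𝒪))
    (hV₁ : V₁ ≠ ⊥) (hV₂ : V₂ ≠ ⊥)
    (hstab₁ : ∀ (g : G), ∀ v ∈ V₁,
      Matrix.mulVec ((ρ g : Matrix (Fin n) (Fin n) 𝒪).map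
        (algebraMap 𝒪 (FractionRing 𝒪))) v ∈ V₁)
    (hstab₂ : ∀ (g : G), ∀ v ∈ V₂,
      Matrix.mulVec ((ρ g : Matrix (Fin n) (Fin n) 𝒪).map
        (algebraMap 𝒪 (FractionRing 𝒪))) v ∈ V₂)
    (hinf : V₁ ⊓ V₂ = ⊥) (hsup : V₁ ⊔ V₂ = ⊤)
    -- `T`, the image of `𝒪ⁿ` in `𝒦ⁿ`, and `Tᵢ = T ∩ Vᵢ`, as `𝒪`-submodules of `𝒦ⁿ`:
    (T T₁ T₂ : Submodule 𝒪 (Fin n → FractionRing 𝒪))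
    (hT : T = LinearMap.range (LinearMap.pi fun i : Fin n =>
      (Algebra.linearMap 𝒪 (FractionRing 𝒪)).comp (LinearMap.proj i)))
    (hT₁ : T₁ = T ⊓ V₁.restrictScalars 𝒪) (hT₂ : T₂ = T ⊓ V₂.restrictScalars 𝒪) :
    ∃ f : 𝒪, f ≠ 0 ∧
      -- `𝒪_f = 𝒪[1/f]`, realized inside the fraction field:
      ∀ (A : Subalgebra 𝒪 (FractionRing 𝒪)),
        A = Algebra.adjoin 𝒪 {(algebraMap 𝒪 (FractionRing 𝒪) f)⁻¹} →
        Module.Free A (Submodule.span A (T₁ : Set (Fin n → FractionRing 𝒪))) ∧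
        Module.Finite A (Submodule.span A (T₁ : Set (Fin n → FractionRing 𝒪))) ∧
        Module.Free A (Submodule.span A (T₂ : Set (Fin n → FractionRing 𝒪))) ∧
        Module.Finite A (Submodule.span A (T₂ : Set (Fin n → FractionRing 𝒪))) ∧
        (∀ (g : G), ∀ v ∈ Submodule.span A (T₁ : Set (Fin n → FractionRing 𝒪)),
          Matrix.mulVec ((ρ g : Matrix (Fin n) (Fin n) 𝒪).map
            (algebraMap 𝒪 (FractionRing 𝒪))) v ∈
            Submodule.span A (T₁ : Set (Fin n → FractionRing 𝒪))) ∧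
        (∀ (g : G), ∀ v ∈ Submodule.span A (T₂ : Set (Fin n → FractionRing 𝒪)),
          Matrix.mulVec ((ρ g : Matrix (Fin n) (Fin n) 𝒪).map
            (algebraMap 𝒪 (FractionRing 𝒪))) v ∈
            Submodule.span A (T₂ : Set (Fin n → FractionRing 𝒪))) ∧
        Submodule.span A (T₁ : Set (Fin n → FractionRing 𝒪)) ⊓
            Submodule.span A (T₂ : Set (Fin n → FractionRing 𝒪)) = ⊥ ∧
        Submodule.span A (T₁ : Set (Fin n → FractionRing 𝒪)) ⊔
            Submodule.span A (T₂ : Set (Fin n → FractionRing 𝒪)) =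
          Submodule.span A (T : Set (Fin n → FractionRing 𝒪)) := by
  have hc : IsCompl V₁ V₂ := IsCompl.of_eq hinf hsup
  obtain ⟨f₁, hf₁, h₁⟩ := exists_localization_free (R := 𝒪) V₁
    (V₁.projectionOnto V₂ hc) (Submodule.projectionOnto_apply_left hc)
  obtain ⟨f₂, hf₂, h₂⟩ := exists_localization_free (R := 𝒪) V₂
    (V₂.projectionOnto V₁ hc.symm) (Submodule.projectionOnto_apply_left hc.symm)
  refine ⟨f₁ * f₂, mul_ne_zero hf₁ hf₂, fun A hA => ?_⟩
  have hfA : (algebraMap 𝒪 (FractionRing 𝒪) (f₁ * f₂))⁻¹ ∈ A :=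
    hA ▸ Algebra.self_mem_adjoin_singleton 𝒪 _
  obtain ⟨hfree₁, hfin₁, hproj₁⟩ := h₁ A (inv_algebraMap_mem_of_mul hf₂ hfA)
  obtain ⟨hfree₂, hfin₂, hproj₂⟩ := h₂ A (inv_algebraMap_mem_of_mul hf₁ (mul_comm f₁ f₂ ▸ hfA))
  subst hT hT₁ hT₂
  refine ⟨hfree₁, hfin₁, hfree₂, hfin₂, fun g v hv => mulVec_mem_span A _ ?_ hv,
    fun g v hv => mulVec_mem_span A _ ?_ hv, ?_, ?_⟩
  · exact fun s hs => ⟨mulVec_mem_standardLattice _ hs.1, hstab₁ g s hs.2⟩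
  · exact fun s hs => ⟨mulVec_mem_standardLattice _ hs.1, hstab₂ g s hs.2⟩
  · rw [eq_bot_iff]
    rintro x ⟨hx₁, hx₂⟩
    have hle₁ : x ∈ V₁.restrictScalars A := Submodule.span_le.2 (fun _ h => h.2) hx₁
    have hle₂ : x ∈ V₂.restrictScalars A := Submodule.span_le.2 (fun _ h => h.2) hx₂
    have hx : x ∈ V₁ ⊓ V₂ := ⟨hle₁, hle₂⟩
    rw [hinf] at hx
    exact hx
  · apply le_antisymm
    · exact sup_le (Submodule.span_mono fun _ h => h.1) (Submodule.span_mono fun _ h => h.1)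
    · refine Submodule.span_le.2 fun t ht => ?_
      have hsum : (V₁.projectionOnto V₂ hc t : Fin n → FractionRing 𝒪) +
          V₂.projectionOnto V₁ hc.symm t = t :=
        Submodule.projection_add_projection_eq_self hc t
      rw [← hsum]
      exact Submodule.add_mem_sup (hproj₁ t ht) (hproj₂ t ht)
end

section
/- Let 𝒪 be an integral domain of characteristic zero, n ≥ 1, and M ∈ GL_n(𝒪) a matrix of finite multiplicative order k > 1 (i.e., M^k is the identity and M is not the identity). Then for every ring homomorphism λ : 𝒪 → Ω into an algebraically closed field Ω of characteristic zero, the matrix λ(M) ∈ GL_n(Ω) obtained by applying λ entrywise has an eigenvalue which is a root of unity different from 1; in particular, λ(M) is not the identity matrix. -/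
/-- In characteristic zero, the geometric sum of a matrix `N` with `N ^ k = 1` has trace
`k` times the rank of the fixed space, and that rank is full only for the identity. -/
theorem Matrix.exists_trace_geom_sum_eq_mul {K : Type*} [Field K] [CharZero K] {n : ℕ}
    (N : Matrix (Fin n) (Fin n) K) {k : ℕ} (hk : k ≠ 0) (hN : N ^ k = 1) :
    ∃ r : ℕ, (∑ i ∈ Finset.range k, N ^ i).trace = k * r ∧ (r = n → N = 1) := by
  have hk' : (k : K) ≠ 0 := Nat.cast_ne_zero.mpr hk
  set S := ∑ i ∈ Finset.range k, N ^ i with hS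
  have hNS : N * S = S := by
    have h := mul_geom_sum N k
    rw [hN, sub_self, sub_mul, one_mul, sub_eq_zero] at h
    exact h
  have hpow (i : ℕ) : N ^ i * S = S := by
    induction i with
    | zero => simp
    | succ i ih => rw [pow_succ, mul_assoc, hNS, ih]
  have hSS : S * S = (k : K) • S := by
    conv_lhs => enter [1]; rw [hS]
    rw [Finset.sum_mul, Finset.sum_congr rfl fun i _ => hpow i, Finset.sum_const,
      Finset.card_range, Nat.cast_smul_eq_nsmul]
  set P := (k : K)⁻¹ • S with hP
  have hPP : P * P = P := by
    rw [hP, smul_mul_smul_comm, hSS, smul_smul, mul_assoc, inv_mul_cancel₀ hk', mul_one]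
  have hidem : IsIdempotentElem (Matrix.toLin' P) := by
    rw [IsIdempotentElem, Module.End.mul_eq_comp, ← Matrix.toLin'_mul, hPP]
  refine ⟨Module.finrank K (LinearMap.range (Matrix.toLin' P)), ?_, fun hr => ?_⟩
  · have h := (LinearMap.IsIdempotentElem.isProj_range _ hidem).trace
    rw [Matrix.trace_toLin'_eq, hP, Matrix.trace_smul, smul_eq_mul] at h
    rw [← h, mul_inv_cancel_left₀ hk']
  · have htop : LinearMap.range (Matrix.toLin' P) = ⊤ :=
      Submodule.eq_top_of_finrank_eq (by rw [hr]; simp)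
    have hunit : IsUnit P := by
      rw [← Matrix.isUnit_toLin'_iff, LinearMap.isUnit_iff_range_eq_top, htop]
    have h : N * P = 1 * P := by rw [hP, mul_smul_comm, hNS, one_mul]
    exact hunit.mul_right_cancel h

/-- A nontrivial matrix of finite order over a domain of characteristic zero stays nontrivial
under any ring homomorphism, injective or not, to a ring of characteristic zero. -/
theorem Matrix.map_ne_one_of_pow_eq_one {R S : Type*} [CommRing R] [IsDomain R] [CharZero R]
    [CommRing S] [IsDomain S] [CharZero S] (f : R →+* S) {n : ℕ}
    {M : Matrix (Fin n) (Fin n) R} {k : ℕ} (hk : k ≠ 0) (hMk : M ^ k = 1) (hM : M ≠ 1) :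
    M.map f ≠ 1 := by
  intro hA
  let ι := algebraMap R (FractionRing R)
  have hι : Function.Injective ι := IsFractionRing.injective R (FractionRing R)
  have : CharZero (FractionRing R) := charZero_of_injective_algebraMap hι
  obtain ⟨r, hr, hrn⟩ := Matrix.exists_trace_geom_sum_eq_mul (ι.mapMatrix M) hk
    (by rw [← map_pow, hMk, map_one])
  have htr : (∑ i ∈ Finset.range k, M ^ i).trace = k * r := by
    apply hι
    rw [map_mul, map_natCast, map_natCast, ← hr, AddMonoidHom.map_trace]
    congr 1
    simp_rw [← map_pow, ← map_sum]
    rfl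
  have htr' : (k : S) * n = k * r := by
    have h := congrArg f htr
    rw [map_mul, map_natCast, map_natCast, AddMonoidHom.map_trace] at h
    rw [← h]
    change _ = (f.mapMatrix (∑ i ∈ Finset.range k, M ^ i)).trace
    rw [map_sum]
    simp_rw [map_pow, RingHom.mapMatrix_apply, hA]
    simp only [one_pow, Matrix.trace_sum]
    simp
  have hrn' : r = n := by
    have h := mul_left_cancel₀ (Nat.cast_ne_zero.mpr hk) htr'
    exact (Nat.cast_injective h).symm
  have h1 := hrn hrn'
  rw [← map_one ι.mapMatrix] at h1
  exact hM (Matrix.map_injective hι h1)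

/-- A nontrivial finite-order element of a finite-dimensional algebra over an algebraically
closed field of characteristic zero has a spectral value other than `1`. -/
theorem exists_mem_spectrum_ne_one_of_pow_eq_one {K B : Type*} [Field K] [IsAlgClosed K]
    [CharZero K] [Ring B] [Algebra K B] [FiniteDimensional K B] {a : B} {k : ℕ} (hk : k ≠ 0)
    (hak : a ^ k = 1) (ha : a ≠ 1) : ∃ ζ ∈ spectrum K a, ζ ≠ 1 := by
  by_contra! hall
  have : Nontrivial B := ⟨a, 1, ha⟩
  let p : Polynomial K := ∑ i ∈ Finset.range k, Polynomial.X ^ i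
  have hp : Polynomial.aeval a p = ∑ i ∈ Finset.range k, a ^ i := by simp [p]
  have hunit : IsUnit (∑ i ∈ Finset.range k, a ^ i) := by
    rw [← hp, ← spectrum.zero_notMem_iff K, spectrum.map_polynomial_aeval_of_nonempty a p
      (spectrum.nonempty_of_isAlgClosed_of_finiteDimensional K a)]
    rintro ⟨ζ, hζ, h0⟩
    rw [hall ζ hζ] at h0
    simp [p, Polynomial.eval_finsetSum, hk] at h0
  have h := mul_geom_sum a k
  rw [hak, sub_self] at h
  exact ha (sub_eq_zero.mp (hunit.mul_left_eq_zero.mp h))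


/-- Let `𝒪` be an integral domain of characteristic zero, `n ≥ 1`, and
`M ∈ GLₙ(𝒪)` of finite multiplicative order `k > 1`. Then for every ring homomorphism
`λ : 𝒪 → Ω` into an algebraically closed field `Ω` of characteristic zero, the matrix
`λ(M)` has an eigenvalue which is a root of unity different from `1`; in particular,
`λ(M)` is not the identity matrix. -/
theorem density_of_ramified_primes_stmt15
    (𝒪 : Type*) [CommRing 𝒪] [IsDomain 𝒪] [CharZero 𝒪]
    (n : ℕ) (hn : 1 ≤ n)
    (M : Matrix.GeneralLinearGroup (Fin n) 𝒪)
    (k : ℕ) (hk : 1 < k) (hMk : M ^ k = 1) (hM : M ≠ 1)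
    (Ω : Type*) [Field Ω] [IsAlgClosed Ω] [CharZero Ω]
    (lam : 𝒪 →+* Ω) :
    (∃ ζ : Ω, (∃ d : ℕ, 1 ≤ d ∧ ζ ^ d = 1) ∧ ζ ≠ 1 ∧
        Module.End.HasEigenvalue
          (Matrix.toLin' (((M : Matrix (Fin n) (Fin n) 𝒪)).map lam)) ζ) ∧
      ((M : Matrix (Fin n) (Fin n) 𝒪)).map lam ≠ 1 := by
  have hk0 : k ≠ 0 := by omega
  have hMk' : (M : Matrix (Fin n) (Fin n) 𝒪) ^ k = 1 := by
    rw [← Units.val_pow_eq_pow_val, hMk, Units.val_one]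
  have hA := Matrix.map_ne_one_of_pow_eq_one lam hk0 hMk' fun h => hM (Units.ext h)
  have hAk : ((M : Matrix (Fin n) (Fin n) 𝒪).map lam) ^ k = 1 := by
    rw [← RingHom.mapMatrix_apply, ← map_pow, hMk', map_one]
  set A := (M : Matrix (Fin n) (Fin n) 𝒪).map lam
  have hTk : Matrix.toLin' A ^ k = 1 := by
    rw [← Matrix.toLin'_pow, hAk, Matrix.toLin'_one]; rfl
  have hT : Matrix.toLin' A ≠ 1 := fun h =>
    hA (Matrix.toLin'.injective (h.trans Matrix.toLin'_one.symm))
  obtain ⟨ζ, hζ, hζ1⟩ := exists_mem_spectrum_ne_one_of_pow_eq_one (K := Ω) hk0 hTk hT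
  have hev := Module.End.hasEigenvalue_iff_mem_spectrum.mpr hζ
  refine ⟨⟨ζ, ⟨k, hk.le, ?_⟩, hζ1, hev⟩, hA⟩
  obtain ⟨v, hv⟩ := hev.exists_hasEigenvector
  have h := hv.pow_apply k
  rw [hTk, Module.End.one_apply] at h
  refine smul_left_injective Ω hv.2 ?_
  simpa using h.symm
end
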